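/- Let V be a vector space over ℝ, let ι be a well-ordered type (a linear order in which < is well-founded), and let (V_i)_{i∈ι} be a monotone (increasing) family of linear subspaces of V with ⋃_{i∈ι} V_i = V. Then there exists a Hamel basis H of V (a linearly independent subset of V whose linear span is V) such that for every i ∈ ι the set H ∩ V_i spans V_i, i.e., H ∩ V_i is a Hamel basis of V_i. -/

import Mathlib

theorem hamel_aux_indep {V : Type*} [AddCommGroup V] [Module ℝ V] [LinearOrder V] :
    LinearIndepOn ℝ id {v : V | v ∉ Submodule.span ℝ (Set.Iio v)} := by
  rw [linearIndepOn_iff_linearIndepOn_finset]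
  intro s
  induction s using Finset.induction_on_max with
  | empty => intro _; simp
  | insert a s ha ih =>
    intro hs
    rw [Finset.coe_insert, Set.insert_subset_iff] at hs
    rw [Finset.coe_insert]
    refine (ih hs.2).insert ?_
    intro h
    refine hs.1 (Submodule.span_mono ?_ h)
    rintro _ ⟨x, hx, rfl⟩
    exact ha x hx

theorem hamel_aux_span {V : Type*} [AddCommGroup V] [Module ℝ V] [LinearOrder V]
    [WellFoundedLT V] (v : V) :
    v ∈ Submodule.span ℝ ({v : V | v ∉ Submodule.span ℝ (Set.Iio v)} ∩ Set.Iic v) := by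
  induction v using WellFoundedLT.induction with
  | ind v ih =>
    by_cases hv : v ∈ Submodule.span ℝ (Set.Iio v)
    · refine Submodule.span_le.2 ?_ hv
      intro w hw
      exact Submodule.span_mono
        (Set.inter_subset_inter_right _ (Set.Iic_subset_Iic.2 (le_of_lt hw))) (ih w hw)
    · exact Submodule.subset_span ⟨hv, le_refl v⟩

theorem hamel_aux_order {V : Type*} {ι : Type*} [LinearOrder ι] [WellFoundedLT ι] (f : V → ι) :
    ∃ _ : LinearOrder V, WellFoundedLT V ∧ ∀ v w : V, v ≤ w → f v ≤ f w := by
  obtain ⟨o, ho⟩ := exists_wellFoundedLT V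
  let g : V → ι ×ₗ V := fun v => toLex (f v, v)
  have hg : Function.Injective g := fun a b h => congrArg (fun p => (ofLex p).2) h
  refine ⟨LinearOrder.lift' g hg, ⟨InvImage.wf g wellFounded_lt⟩, ?_⟩
  intro v w h
  have h' : g v ≤ g w := h
  rcases Prod.Lex.toLex_le_toLex.1 h' with h | h
  · exact le_of_lt h
  · exact le_of_eq h.1

/-- If a vector space `V` is the union of a monotone family of subspaces indexed by a
well-ordered type, then `V` has a Hamel basis `H` such that `H ∩ V_i` is a Hamel basis of
`V_i` for every `i`. -/
theorem exists_hamel_basis_compatible_with_filtration {V : Type*} [AddCommGroup V]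
    [Module ℝ V] {ι : Type*} [LinearOrder ι] [WellFoundedLT ι]
    (W : ι → Submodule ℝ V) (hmono : Monotone W)
    (hunion : (⋃ i, (W i : Set V)) = Set.univ) :
    ∃ H : Set V,
      LinearIndependent ℝ ((↑) : H → V) ∧
      Submodule.span ℝ H = ⊤ ∧
      ∀ i, Submodule.span ℝ (H ∩ (W i : Set V)) = W i := by
  have hne : ∀ v : V, {i | v ∈ W i}.Nonempty := fun v => by
    have h : v ∈ ⋃ i, (W i : Set V) := hunion ▸ Set.mem_univ v
    exact Set.mem_iUnion.1 h
  let f : V → ι := fun v => (wellFounded_lt (α := ι)).min {i | v ∈ W i} (hne v)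
  have hf : ∀ v, v ∈ W (f v) := fun v => (wellFounded_lt (α := ι)).min_mem _ (hne v)
  have hf' : ∀ v i, v ∈ W i → f v ≤ i := fun v i h =>
    not_lt.1 ((wellFounded_lt (α := ι)).not_lt_min {i | v ∈ W i} h)
  obtain ⟨o, ho, hof⟩ := hamel_aux_order f
  refine ⟨{v : V | v ∉ Submodule.span ℝ (Set.Iio v)}, hamel_aux_indep, ?_, ?_⟩
  · rw [eq_top_iff]
    intro v _
    exact Submodule.span_mono Set.inter_subset_left (hamel_aux_span v)
  · intro i
    apply le_antisymm
    · exact Submodule.span_le.2 Set.inter_subset_right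
    · intro v hv
      refine Submodule.span_mono (Set.inter_subset_inter_right _ ?_) (hamel_aux_span v)
      intro w hw
      exact hmono ((hof w v hw).trans (hf' v i hv)) (hf w)
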